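/- Let S = 1^{n_1}0^{m_1}⋯1^{n_r}0^{m_r} with all n_j, m_j ≥ 1 and n_1+⋯+n_r = m_1+⋯+m_r, and let h = h(S) be its lattice-path height. Then φ(S) ≤ C_r^{(h)} = (1/(hr+1))·C((h+1)r, r), and moreover C_r^{(h)} ≤ (r^{r−1}/r!)·(1+h)^{r−1} as real numbers. -/

import Mathlib

/-- A pairing of the positions `Fin N`: a collection of blocks, each of size 2,
with every position in exactly one block. -/
def IsPairing {N : ℕ} (π : Finset (Finset (Fin N))) : Prop :=
  (∀ B ∈ π, B.card = 2) ∧ ∀ i : Fin N, ∃! B, B ∈ π ∧ i ∈ B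

/-- A crossing: blocks `{i₁,i₂}` and `{j₁,j₂}` with `i₁ < j₁ < i₂ < j₂`. -/
def HasCrossing {N : ℕ} (π : Finset (Finset (Fin N))) : Prop :=
  ∃ B ∈ π, ∃ C ∈ π, ∃ i₁ i₂ j₁ j₂ : Fin N,
    i₁ ∈ B ∧ i₂ ∈ B ∧ j₁ ∈ C ∧ j₂ ∈ C ∧ i₁ < j₁ ∧ j₁ < i₂ ∧ i₂ < j₂

/-- A non-crossing `w`-pairing: a non-crossing pairing of the positions of the
bitstring `w` (ones are `true`, zeros are `false`) pairing unequal letters. -/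
def IsNCPairingOn (w : List Bool) (π : Finset (Finset (Fin w.length))) : Prop :=
  IsPairing π ∧ ¬ HasCrossing π ∧
    ∀ B ∈ π, ∀ i ∈ B, ∀ j ∈ B, i ≠ j → w.get i ≠ w.get j

/-- `phi w` is the number of non-crossing `w`-pairings. -/
noncomputable def phi (w : List Bool) : ℕ :=
  Set.ncard {π : Finset (Finset (Fin w.length)) | IsNCPairingOn w π}

/-- The word `1^{n 0} 0^{m 0} 1^{n 1} 0^{m 1} ⋯ 1^{n (r-1)} 0^{m (r-1)}`. -/
def runsF {r : ℕ} (n m : Fin r → ℕ) : List Bool :=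
  (List.finRange r).flatMap fun i => List.replicate (n i) true ++ List.replicate (m i) false

/-- The word `1^{k₁} 0^{k₁} ⋯ 1^{k_r} 0^{k_r}` for `l = [k₁, …, k_r]`. -/
def symWord (l : List ℕ) : List Bool :=
  l.flatMap fun k => List.replicate k true ++ List.replicate k false

/-- The symmetrized pairing function `φ*(n₁,…,n_r) = φ(1^{n₁}0^{n₁}⋯1^{n_r}0^{n_r})`. -/
noncomputable def phiStar (l : List ℕ) : ℕ := phi (symWord l)

/-- `Yval w i` is the lattice-path value `Y_i`. -/
def Yval (w : List Bool) (i : ℕ) : ℤ :=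
  ((w.take i).count true : ℤ) - ((w.take i).count false : ℤ)

/-- The height of position `i` of `w`, relative to the minimum `mY` of the `Y_i`. -/
def heightAt (w : List Bool) (mY : ℤ) (i : Fin w.length) : ℤ :=
  if w.get i then Yval w (i.val + 1) - mY else Yval w (i.val + 1) - mY + 1

/-- `d : Fin r → ℕ` is a Catalan degree sequence of order `r`. -/
def IsCatalanSeq (r : ℕ) (d : Fin r → ℕ) : Prop :=
  (∀ i : ℕ, 1 ≤ i → i ≤ r - 1 →
      (i : ℕ) ≤ ∑ j ∈ Finset.univ.filter (fun j : Fin r => (j : ℕ) < i), d j) ∧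
  ∑ j, d j = r - 1

/-- Sum of the first `j` values of `f`. -/
def prefSum {r : ℕ} (f : Fin r → ℕ) (j : ℕ) : ℕ :=
  ∑ i ∈ Finset.univ.filter (fun i : Fin r => (i : ℕ) < j), f i

/-- `m` is a member of `CF(n)`. -/
def InCF {r : ℕ} (n m : Fin r → ℕ) : Prop :=
  (∀ j : ℕ, 1 ≤ j → j ≤ r - 1 → prefSum m j ≤ prefSum n j) ∧
  (∑ i, m i = ∑ i, n i)

/-! ### Push/pop encodings -/

/-- All push (`true`) / pop (`false`) sequences that read the word from the given stack, popping
only a letter different from the one being read, and end with the empty stack. -/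
def stackRuns : List Bool → List Bool → List (List Bool)
  | [], [] => [[]]
  | _ :: _, [] => []
  | [], b :: w => (stackRuns [b] w).map (true :: ·)
  | c :: st, b :: w =>
      (stackRuns (b :: c :: st) w).map (true :: ·) ++
        if c = !b then (stackRuns st w).map (false :: ·) else []

/-- The number of push/pop sequences reading `w` from the stack `st`. -/
def stackCount (st w : List Bool) : ℕ := (stackRuns st w).length

@[simp] lemma stackCount_nil_nil : stackCount [] [] = 1 := by simp [stackCount, stackRuns]

@[simp] lemma stackCount_cons_nil (c : Bool) (st : List Bool) : stackCount (c :: st) [] = 0 := by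
  simp [stackCount, stackRuns]

@[simp] lemma stackCount_nil_cons (b : Bool) (w : List Bool) :
    stackCount [] (b :: w) = stackCount [b] w := by
  simp [stackCount, stackRuns]

lemma stackCount_cons_cons (b c : Bool) (st w : List Bool) :
    stackCount (c :: st) (b :: w) =
      stackCount (b :: c :: st) w + if c = !b then stackCount st w else 0 := by
  unfold stackCount
  rw [stackRuns]
  split_ifs <;> simp

/-- `p` is the partner function of a non-crossing pairing of the positions of `w`
matching unequal letters. -/
structure IsPartner (w : List Bool) (p : ℕ → ℕ) : Prop where
  lt : ∀ i < w.length, p i < w.length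
  ne : ∀ i < w.length, p i ≠ i
  invol : ∀ i < w.length, p (p i) = i
  letter : ∀ i < w.length, w.getD (p i) false = !w.getD i false
  nc : ∀ i < w.length, ∀ j < w.length, i < j → j < p i → p i < p j → False

/-- The stack of open positions just before reading position `t`. -/
def openStack (p : ℕ → ℕ) : ℕ → List ℕ
  | 0 => []
  | t + 1 => if t < p t then t :: openStack p t else (openStack p t).tail

lemma IsPartner.openStack_spec {w : List Bool} {p : ℕ → ℕ} (hp : IsPartner w p) (t : ℕ)
    (ht : t ≤ w.length) :
    (openStack p t).Pairwise (· > ·) ∧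
      (∀ i, i ∈ openStack p t ↔ i < t ∧ t ≤ p i) ∧
      (t < w.length → p t < t → ∃ s, openStack p t = p t :: s) := by
  have head : ∀ t, t ≤ w.length → (openStack p t).Pairwise (· > ·) →
      (∀ i, i ∈ openStack p t ↔ i < t ∧ t ≤ p i) →
      (t < w.length → p t < t → ∃ s, openStack p t = p t :: s) := by
    intro t ht hs hm htl hpt
    have hmem : p t ∈ openStack p t := (hm _).2 ⟨hpt, (hp.invol t htl).ge⟩
    rcases hst : openStack p t with _ | ⟨c, s⟩
    · simp [hst] at hmem
    · refine ⟨s, ?_⟩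
      rw [hst] at hmem hs
      have hc := (hm c).1 (by simp [hst])
      rcases List.mem_cons.1 hmem with h | h
      · rw [h]
      · exfalso
        have h1 : c > p t := List.rel_of_pairwise_cons hs h
        have h2 : p c ≠ t := by
          intro h3
          have := hp.invol c (by omega)
          rw [h3] at this
          omega
        have := hp.invol t htl
        exact hp.nc (p t) (hp.lt t htl) c (by omega) h1 (by omega) (by omega)
  induction t with
  | zero => exact ⟨by simp [openStack], by simp [openStack], by omega⟩
  | succ t ih =>
    obtain ⟨hs, hm, hh⟩ := ih (by omega)
    have key : (openStack p (t + 1)).Pairwise (· > ·) ∧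
        (∀ i, i ∈ openStack p (t + 1) ↔ i < t + 1 ∧ t + 1 ≤ p i) := by
      have hinv := hp.invol t (by omega)
      have hne := hp.ne t (by omega)
      have hpi : ∀ i, i < t → p i = t → p t = i := by
        intro i hi h3
        have := hp.invol i (by omega)
        rwa [h3] at this
      rw [openStack]
      split_ifs with hlt
      · refine ⟨List.pairwise_cons.2 ⟨fun i hi => ((hm i).1 hi).1, hs⟩, fun i => ?_⟩
        rw [List.mem_cons, hm]
        constructor
        · rintro (rfl | h)
          · omega
          · have := hpi i h.1
            omega
        · intro h
          by_cases hit : i = t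
          · exact Or.inl hit
          · right; omega
      · obtain ⟨s, hst⟩ := hh (by omega) (by omega)
        rw [hst] at hs ⊢
        refine ⟨(List.pairwise_cons.1 hs).2, fun i => ?_⟩
        have hmi := hm i
        rw [hst, List.mem_cons] at hmi
        rw [List.tail_cons]
        constructor
        · intro hi
          have h1 : p t > i := List.rel_of_pairwise_cons hs hi
          have h2 := hmi.1 (Or.inr hi)
          have := hpi i h2.1
          omega
        · intro h
          have hit : i ≠ t := by rintro rfl; omega
          rcases hmi.2 (by omega) with h1 | h1
          · rw [h1] at h; omega
          · exact h1
    exact ⟨key.1, key.2, head _ ht key.1 key.2⟩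

/-- The push/pop sequence of `p` on positions `t, …, t + k - 1`. -/
def flags (p : ℕ → ℕ) (t k : ℕ) : List Bool :=
  (List.range' t k).map fun i => decide (i < p i)

lemma IsPartner.flags_mem {w : List Bool} {p : ℕ → ℕ} (hp : IsPartner w p) (k t : ℕ)
    (ht : t + k = w.length) :
    flags p t k ∈ stackRuns ((openStack p t).map (w.getD · false)) (w.drop t) := by
  induction k generalizing t with
  | zero =>
    have h0 : openStack p t = [] := by
      refine List.eq_nil_iff_forall_not_mem.2 fun i hi => ?_
      have h1 := ((hp.openStack_spec t (by omega)).2.1 i).1 hi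
      have := hp.lt i (by omega)
      omega
    rw [h0, List.drop_of_length_le (by omega)]
    simp [flags, stackRuns]
  | succ k ih =>
    have htl : t < w.length := by omega
    have ih' := ih (t + 1) (by omega)
    have hget : w.getD t false = w[t] := by simp [htl]
    have hfl : flags p t (k + 1) = decide (t < p t) :: flags p (t + 1) k := by
      simp [flags, List.range'_succ]
    rw [List.drop_eq_getElem_cons htl, hfl, ← hget]
    rw [openStack] at ih'
    split_ifs at ih' with hlt
    · rw [decide_eq_true hlt]
      rcases hst : openStack p t with _ | ⟨c, s⟩
      · rw [hst] at ih'
        simpa [stackRuns] using ih'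
      · rw [hst] at ih'
        simp only [List.map_cons, stackRuns, List.mem_append]
        left
        simpa using ih'
    · rw [decide_eq_false hlt]
      have hne := hp.ne t htl
      obtain ⟨s, hst⟩ := (hp.openStack_spec t (by omega)).2.2 htl (by omega)
      rw [hst] at ih' ⊢
      simp only [List.map_cons, stackRuns, List.mem_append]
      right
      rw [if_pos (hp.letter t htl)]
      simpa using ih'

lemma IsPartner.eq_of_flags_eq {w : List Bool} {p q : ℕ → ℕ} (hp : IsPartner w p)
    (hq : IsPartner w q) (h : flags p 0 w.length = flags q 0 w.length) :
    ∀ i < w.length, p i = q i := by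
  have hf : ∀ i < w.length, (i < p i ↔ i < q i) := by
    intro i hi
    have := List.map_inj_left.1 h i (by simp [hi])
    simpa using this
  have hst : ∀ t ≤ w.length, openStack p t = openStack q t := by
    intro t
    induction t with
    | zero => intro _; rfl
    | succ t ih =>
      intro ht
      simp only [openStack, ih (by omega), hf t (by omega)]
  have hcl : ∀ t < w.length, p t < t → p t = q t := by
    intro t ht hpt
    have hne := hq.ne t ht
    have h1 := hf t ht
    obtain ⟨s, hs⟩ := (hp.openStack_spec t ht.le).2.2 ht hpt
    obtain ⟨s', hs'⟩ := (hq.openStack_spec t ht.le).2.2 ht (by omega)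
    rw [hst t ht.le, hs'] at hs
    exact (List.cons.inj hs).1.symm
  intro i hi
  rcases lt_or_gt_of_ne (hp.ne i hi) with h1 | h1
  · exact hcl i hi h1
  · have h2 := hp.invol i hi
    have h3 := hcl (p i) (hp.lt i hi) (by omega)
    have h4 := hq.invol (p i) (hp.lt i hi)
    rw [← h3, h2] at h4
    exact h4.symm

lemma IsNCPairingOn.exists_partner {w : List Bool} {π : Finset (Finset (Fin w.length))}
    (h : IsNCPairingOn w π) :
    ∃ p : ℕ → ℕ, IsPartner w p ∧
      ∀ B : Finset (Fin w.length), B ∈ π ↔ ∃ i j : Fin w.length, p i = j ∧ B = {i, j} := by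
  obtain ⟨⟨hcard, hcov⟩, hnc, hlet⟩ := h
  have hex : ∀ i : Fin w.length, ∃ j, j ≠ i ∧ ({i, j} : Finset (Fin w.length)) ∈ π := by
    intro i
    obtain ⟨B, ⟨hB, hi⟩, -⟩ := hcov i
    obtain ⟨x, y, hxy, rfl⟩ := Finset.card_eq_two.1 (hcard B hB)
    rcases Finset.mem_insert.1 hi with rfl | hi
    · exact ⟨y, hxy.symm, hB⟩
    · rw [Finset.mem_singleton] at hi
      subst hi
      exact ⟨x, hxy, by rwa [Finset.pair_comm]⟩
  choose f hf hfπ using hex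
  have huniq : ∀ (i : Fin w.length) (B : Finset _), B ∈ π → i ∈ B → B = {i, f i} :=
    fun i B hB hi => (hcov i).unique ⟨hB, hi⟩ ⟨hfπ i, by simp⟩
  have hinv : ∀ i, f (f i) = i := by
    intro i
    have h1 := huniq (f i) {i, f i} (hfπ i) (by simp)
    have h2 : i ∈ ({f i, f (f i)} : Finset (Fin w.length)) := h1 ▸ (by simp)
    rcases Finset.mem_insert.1 h2 with h | h
    · exact absurd h.symm (hf i)
    · exact (Finset.mem_singleton.1 h).symm
  let p : ℕ → ℕ := fun i => if hi : i < w.length then f ⟨i, hi⟩ else 0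
  have hpf : ∀ i : Fin w.length, p i = f i := fun i => by simp [p]
  refine ⟨p, ⟨?_, ?_, ?_, ?_, ?_⟩, ?_⟩
  · intro i hi
    have := hpf ⟨i, hi⟩
    dsimp only at this
    rw [this]
    exact (f _).isLt
  · intro i hi h
    have h1 := hpf ⟨i, hi⟩
    dsimp only at h1
    exact hf ⟨i, hi⟩ (Fin.ext (h1.symm.trans h))
  · intro i hi
    have h1 := hpf ⟨i, hi⟩
    dsimp only at h1
    rw [h1, hpf, hinv]
  · intro i hi
    have h1 := hpf ⟨i, hi⟩
    dsimp only at h1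
    have h2 := hlet _ (hfπ ⟨i, hi⟩) (f ⟨i, hi⟩) (by simp) ⟨i, hi⟩ (by simp) (hf _)
    rw [h1, List.getD_eq_getElem _ _ (f ⟨i, hi⟩).isLt, List.getD_eq_getElem _ _ hi]
    simp only [List.get_eq_getElem] at h2
    exact Bool.eq_not_of_ne h2
  · intro i hi j hj hij hji hpp
    have h1 := hpf ⟨i, hi⟩
    have h2 := hpf ⟨j, hj⟩
    dsimp only at h1 h2
    refine hnc ⟨_, hfπ ⟨i, hi⟩, _, hfπ ⟨j, hj⟩, ⟨i, hi⟩, f ⟨i, hi⟩, ⟨j, hj⟩, f ⟨j, hj⟩,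
      by simp, by simp, by simp, by simp, hij, ?_, ?_⟩
    · rw [Fin.lt_def]; dsimp only; omega
    · rw [Fin.lt_def]; omega
  · intro B
    constructor
    · intro hB
      obtain ⟨i, hi⟩ : B.Nonempty := Finset.card_pos.1 (by rw [hcard B hB]; norm_num)
      exact ⟨i, f i, hpf i, huniq i B hB hi⟩
    · rintro ⟨i, j, hij, rfl⟩
      have : f i = j := Fin.ext ((hpf i).symm.trans hij)
      exact this ▸ hfπ i

lemma phi_le_stackCount (w : List Bool) : phi w ≤ stackCount [] w := by
  classical
  have hch : ∀ π : Finset (Finset (Fin w.length)), ∃ p : ℕ → ℕ, IsNCPairingOn w π →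
      IsPartner w p ∧
        ∀ B : Finset (Fin w.length), B ∈ π ↔ ∃ i j : Fin w.length, p i = j ∧ B = {i, j} := by
    intro π
    by_cases h : IsNCPairingOn w π
    · obtain ⟨p, hp⟩ := h.exists_partner
      exact ⟨p, fun _ => hp⟩
    · exact ⟨id, fun h' => absurd h' h⟩
  choose p hp using hch
  have hle : phi w ≤ Set.ncard (↑(stackRuns [] w).toFinset : Set (List Bool)) := by
    refine Set.ncard_le_ncard_of_injOn (fun π => flags (p π) 0 w.length) ?_ ?_
      (Finset.finite_toSet _)
    · intro π hπ
      have := (hp π hπ).1.flags_mem w.length 0 (by omega)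
      simpa [openStack] using this
    · intro π hπ ρ hρ heq
      have hpq := (hp π hπ).1.eq_of_flags_eq (hp ρ hρ).1 heq
      ext B
      rw [(hp π hπ).2, (hp ρ hρ).2]
      refine exists_congr fun i => exists_congr fun j => ?_
      rw [hpq i i.isLt]
  rw [Set.ncard_coe_finset] at hle
  exact hle.trans (List.toFinset_card_le _)

/-! ### Raney numbers -/

/-- Raney numbers: the coefficient of `x ^ r` in `F ^ k`, where `F = 1 + x F ^ (h + 1)`. -/
def raney (h : ℕ) : ℕ → ℕ → ℕ
  | 0, _ => 1
  | _ + 1, 0 => 0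
  | r + 1, k + 1 => raney h (r + 1) k + raney h r (k + 1 + h)
termination_by r k => (r, k)

lemma raney_add (h r k : ℕ) :
    raney h (r + 1) k + h * ((h + 1) * (r + 1) + k - 1).choose r =
      ((h + 1) * (r + 1) + k - 1).choose (r + 1) := by
  induction r generalizing k with
  | zero =>
    induction k with
    | zero => simp [raney]
    | succ k ih =>
      rw [raney, raney]
      simp at ih ⊢
      omega
  | succ r ihr =>
    induction k with
    | zero =>
      obtain ⟨N, hN⟩ : ∃ N, (h + 1) * (r + 1 + 1) + 0 - 1 = N := ⟨_, rfl⟩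
      have hN' : N = (r + 2) * h + (r + 1) := by
        rw [← hN]
        have : (h + 1) * (r + 1 + 1) + 0 = (r + 2) * h + (r + 1) + 1 := by ring
        omega
      have hc := Nat.choose_succ_right_eq N (r + 1)
      rw [show N - (r + 1) = (r + 2) * h by omega] at hc
      rw [hN, raney, zero_add]
      refine Nat.eq_of_mul_eq_mul_right (Nat.succ_pos (r + 1)) ?_
      rw [Nat.succ_eq_add_one, hc]
      ring
    | succ k ih =>
      have h2 := ihr (k + 1 + h)
      obtain ⟨N, hN⟩ : ∃ N, (h + 1) * (r + 1 + 1) + k - 1 = N := ⟨_, rfl⟩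
      have h1 : 0 < (h + 1) * (r + 1 + 1) := by positivity
      have e1 : (h + 1) * (r + 1 + 1) + (k + 1) - 1 = N + 1 := by omega
      have e2 : (h + 1) * (r + 1) + (k + 1 + h) - 1 = N := by
        rw [← hN]
        congr 1
        ring
      rw [hN] at ih
      rw [e2] at h2
      rw [e1, raney, Nat.choose_succ_succ, Nat.choose_succ_succ, ← ih, ← h2]
      ring

lemma raney_one_mul (h r : ℕ) :
    raney h r 1 * (h * r + 1) = ((h + 1) * r).choose r := by
  rcases r with _ | r
  · simp [raney]
  · have h1 := raney_add h r 1
    rw [Nat.add_sub_cancel] at h1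
    have h2 := Nat.choose_succ_right_eq ((h + 1) * (r + 1)) r
    have e : (h + 1) * (r + 1) - r = h * (r + 1) + 1 := by
      have : (h + 1) * (r + 1) = h * (r + 1) + 1 + r := by ring
      omega
    rw [e] at h2
    nlinarith

/-- Raney numbers with an integer first index, zero at negative indices. -/
def raneyInt (h : ℕ) (R : ℤ) (k : ℕ) : ℕ := if 0 ≤ R then raney h R.toNat k else 0

lemma raneyInt_succ_le (h : ℕ) (R : ℤ) (k : ℕ) :
    raneyInt h R k + raneyInt h (R - 1) (k + 1 + h) ≤ raneyInt h R (k + 1) := by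
  rcases lt_trichotomy R 0 with hR | rfl | hR
  · simp [raneyInt, hR.not_ge, show ¬ (1 : ℤ) ≤ R by omega]
  · simp [raneyInt, raney]
  · obtain ⟨s, rfl⟩ : ∃ s : ℕ, R = s + 1 := ⟨(R - 1).toNat, by omega⟩
    have e1 : ((s : ℤ) + 1).toNat = s + 1 := by omega
    have e2 : (0 : ℤ) ≤ s + 1 := by omega
    have e3 : ((s : ℤ) + 1 - 1).toNat = s := by omega
    have e4 : (0 : ℤ) ≤ (s : ℤ) + 1 - 1 := by omega
    rw [raneyInt, raneyInt, raneyInt, if_pos e2, if_pos e2, if_pos e4, e1, e3, raney]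

/-! ### Words made of full runs -/

/-- `k` alternating runs of length `h`, the first one of the letter `b`. -/
def altRuns (h : ℕ) : Bool → ℕ → List Bool
  | _, 0 => []
  | b, k + 1 => List.replicate h b ++ altRuns h (!b) k

/-- The level (ones minus zeros) of a stack. -/
def level : List Bool → ℕ
  | [] => 0
  | true :: s => level s + 1
  | false :: s => level s - 1

/-- The lattice path of the stack stays in the strip `[0, h]`. -/
def InStrip (h : ℕ) : List Bool → Prop
  | [] => True
  | true :: s => InStrip h s ∧ level s < h
  | false :: s => InStrip h s ∧ 0 < level s

/-- The number of letters `b` that can be read from level `y` without leaving `[0, h]`. -/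
def room (h : ℕ) (b : Bool) (y : ℕ) : ℕ := if b then h - y else y

/-- The room left at a turn of the stack, if its top letter is `b`. -/
def turnRoom (h : ℕ) (st : List Bool) (b : Bool) : ℕ :=
  if st.head? = some b then room h b (level st) else 0

/-- The total room left at the turns of the stack. -/
def slack (h : ℕ) : List Bool → ℕ
  | [] => 0
  | c :: st => slack h st + turnRoom h st (!c)

lemma level_le {h : ℕ} {st : List Bool} (hs : InStrip h st) : level st ≤ h := by
  induction st with
  | nil => simp [level]
  | cons c s ih =>
    cases c
    · have := ih hs.1
      simp only [level]
      omega
    · have := hs.2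
      simp only [level]
      omega

lemma stackCount_replicate_step {h q j : ℕ}
    (ih : ∀ (b : Bool) (st : List Bool), InStrip h st → j = room h b (level st) → ∀ R : ℤ,
      (j : ℤ) + h * q = st.length + 2 * (slack h st + turnRoom h st b) + 2 * h * R →
      stackCount st (List.replicate j b ++ altRuns h (!b) q) ≤
        raneyInt h R (1 + st.length + slack h st + turnRoom h st b))
    (b : Bool) (st : List Bool) (hst : InStrip h st) (hj : j + 1 = room h b (level st)) (R : ℤ)
    (hR : ((j + 1 : ℕ) : ℤ) + h * q =
      st.length + 2 * (slack h st + turnRoom h st b) + 2 * h * R) :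
    stackCount st (List.replicate (j + 1) b ++ altRuns h (!b) q) ≤
      raneyInt h R (1 + st.length + slack h st + turnRoom h st b) := by
  rw [List.replicate_succ, List.cons_append]
  have hlev := level_le hst
  have hpush : InStrip h (b :: st) := by
    cases b <;> simp only [InStrip, room] at hj ⊢
    · exact ⟨hst, by simp at hj; omega⟩
    · exact ⟨hst, by simp at hj; omega⟩
  have hroom : j = room h b (level (b :: st)) := by
    cases b <;> simp [level, room] at hj ⊢ <;> omega
  have hopp : j + 1 + room h (!b) (level st) = h := by
    cases b <;> simp [room] at hj ⊢ <;> omega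
  have hturn : turnRoom h (b :: st) b = j := by
    simp [turnRoom, ← hroom]
  have push := ih b (b :: st) hpush hroom
  rw [hturn] at push
  rcases st with _ | ⟨c, s⟩
  · have e1 : slack h [b] = 0 := by simp [slack, turnRoom]
    have e2 : j + 1 = h := by cases b <;> simp [room, level] at hj hopp; omega
    have := push (R - 1) (by
      simp [slack, turnRoom] at hR ⊢
      have : (h : ℤ) = j + 1 := by omega
      linarith)
    rw [stackCount_nil_cons]
    refine this.trans ?_
    have h3 := raneyInt_succ_le h R 0
    have e3 : 1 + [b].length + slack h [b] + j = 0 + 1 + h := by simp [e1]; omega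
    have e4 : 1 + ([] : List Bool).length + slack h [] + turnRoom h [] b = 0 + 1 := by
      simp [slack, turnRoom]
    rw [e3, e4]
    omega
  · rw [stackCount_cons_cons]
    by_cases hc : c = !b
    · rw [if_pos hc]
      subst hc
      have e1 : turnRoom h ((!b) :: s) b = 0 := by cases b <;> simp [turnRoom]
      have e2 : slack h ((!b) :: s) = slack h s + turnRoom h s b := by simp [slack]
      have e3 : slack h (b :: (!b) :: s) =
          slack h ((!b) :: s) + room h (!b) (level ((!b) :: s)) := by
        simp [slack, turnRoom]
      have hs : InStrip h s := by cases b <;> exact hst.1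
      have hjs : j = room h b (level s) := by
        cases b <;> simp [level, room, InStrip] at hj hst ⊢ <;> omega
      have pop := ih b s hs hjs R (by
        rw [e1, e2] at hR
        push_cast [List.length_cons] at hR ⊢
        linarith)
      have push' := push (R - 1) (by
        rw [e1] at hR
        rw [e3]
        push_cast [List.length_cons] at hR ⊢
        have : (h : ℤ) = j + 1 + room h (!b) (level ((!b) :: s)) := by omega
        linarith)
      have h3 := raneyInt_succ_le h R (1 + s.length + slack h s + turnRoom h s b)
      have e4 : 1 + (b :: (!b) :: s).length + slack h (b :: (!b) :: s) + j =
          1 + s.length + slack h s + turnRoom h s b + 1 + h := by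
        rw [e3, e2]
        simp only [List.length_cons]
        omega
      have e5 : 1 + ((!b) :: s).length + slack h ((!b) :: s) + turnRoom h ((!b) :: s) b =
          1 + s.length + slack h s + turnRoom h s b + 1 := by
        rw [e1, e2]
        simp only [List.length_cons]
        omega
      rw [e4] at push'
      rw [e5]
      omega
    · rw [if_neg hc, add_zero]
      have hc' : c = b := by cases b <;> cases c <;> simp_all
      subst hc'
      have e1 : turnRoom h (c :: s) c = j + 1 := by simp [turnRoom, ← hj]
      have e3 : slack h (c :: c :: s) = slack h (c :: s) := by
        cases c <;> simp [slack, turnRoom]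
      refine (push R ?_).trans (le_of_eq ?_)
      · rw [e1] at hR
        rw [e3]
        push_cast [List.length_cons] at hR ⊢
        linarith
      · rw [e1, e3]
        congr 1
        simp only [List.length_cons]
        omega

lemma stackCount_altRuns_le {h : ℕ} (hh : 0 < h) (q j : ℕ) (b : Bool) (st : List Bool)
    (hst : InStrip h st) (hj : j = room h b (level st)) (R : ℤ)
    (hR : (j : ℤ) + h * q = st.length + 2 * (slack h st + turnRoom h st b) + 2 * h * R) :
    stackCount st (List.replicate j b ++ altRuns h (!b) q) ≤
      raneyInt h R (1 + st.length + slack h st + turnRoom h st b) := by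
  induction q generalizing j b st R with
  | zero =>
    induction j generalizing b st R with
    | zero =>
      rcases st with _ | ⟨c, s⟩
      · have hR0 : R = 0 := by
          simp [slack, turnRoom] at hR
          omega
        simp [hR0, altRuns, slack, turnRoom, raneyInt, raney]
      · simp [altRuns]
    | succ j ihj =>
      exact stackCount_replicate_step (fun b st h1 h2 R h3 => ihj b st h1 h2 R h3) b st hst hj R hR
  | succ q ihq =>
    induction j generalizing b st R with
    | zero =>
      have hlev := level_le hst
      have hopp : h = room h (!b) (level st) := by
        cases b <;> simp [room] at hj ⊢ <;> omega
      have ht : turnRoom h st (!b) = turnRoom h st b := by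
        rcases st with _ | ⟨c, s⟩
        · simp [turnRoom]
        · have hs : InStrip h s := by cases c <;> exact hst.1
          have := level_le hs
          by_cases hc : c = b
          · subst hc
            cases c <;> simp [turnRoom, ← hj]
          · exfalso
            cases b <;> cases c <;> simp [InStrip, level, room] at hst hj hc <;> omega
      have := ihq h (!b) st hst hopp R (by
        rw [ht]
        push_cast at hR
        linarith)
      rw [ht, Bool.not_not] at this
      simpa [altRuns] using this
    | succ j ihj =>
      exact stackCount_replicate_step (fun b st h1 h2 R h3 => ihj b st h1 h2 R h3) b st hst hj R hR

lemma stackCount_fullRuns_le {h r : ℕ} (hh : 0 < h) (hr : 0 < r) :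
    stackCount [] (altRuns h true (2 * r)) ≤ raney h r 1 := by
  obtain ⟨s, rfl⟩ : ∃ s, r = s + 1 := ⟨r - 1, by omega⟩
  have := stackCount_altRuns_le hh (2 * s + 1) h true [] trivial (by simp [room, level])
    ((s + 1 : ℕ) : ℤ) (by simp [slack, turnRoom]; ring)
  simpa [slack, turnRoom, raneyInt, altRuns, Nat.mul_add,
    show ¬ ((s : ℤ) + 1 < 0) by omega, show (0 : ℤ) ≤ (s : ℤ) + 1 by omega] using this

/-! ### Comparing words -/

lemma stackCount_append_mono {x y : List Bool} (hxy : ∀ st, stackCount st x ≤ stackCount st y)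
    (u st : List Bool) : stackCount st (u ++ x) ≤ stackCount st (u ++ y) := by
  induction u generalizing st with
  | nil => exact hxy st
  | cons b u ih =>
    rcases st with _ | ⟨c, st⟩
    · simpa using ih [b]
    · simp only [List.cons_append, stackCount_cons_cons]
      have := ih (b :: c :: st)
      have := ih st
      split_ifs <;> omega

lemma stackCount_push_le (b : Bool) (st w : List Bool) :
    stackCount (b :: st) w ≤ stackCount st (b :: w) := by
  rcases st with _ | ⟨c, st⟩
  · simp
  · rw [stackCount_cons_cons]
    omega

lemma stackCount_le_insert (b : Bool) (k : ℕ) (st y : List Bool) :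
    stackCount st y ≤
      stackCount st (List.replicate k b ++ (List.replicate k (!b) ++ y)) := by
  induction k generalizing y with
  | zero => simp
  | succ k ih =>
    have h1 : ∀ y st, stackCount st y ≤ stackCount st (b :: (!b) :: y) := fun y st =>
      le_trans (by rw [stackCount_cons_cons]; simp) (stackCount_push_le b st ((!b) :: y))
    refine ((ih y).trans (stackCount_append_mono (fun st => h1 _ st) (List.replicate k b) st)).trans
      (le_of_eq ?_)
    rw [List.replicate_succ', List.replicate_succ, List.append_assoc]
    rfl

lemma stackCount_le_wrap (w st : List Bool) :
    stackCount st w ≤ stackCount (st ++ [true]) (w ++ [false]) := by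
  induction w generalizing st with
  | nil =>
    rcases st with _ | ⟨c, st⟩
    · simp [stackCount_cons_cons]
    · simp
  | cons b w ih =>
    rcases st with _ | ⟨c, st⟩
    · have := ih [b]
      simp only [List.nil_append, List.cons_append, stackCount_nil_cons, stackCount_cons_cons]
        at this ⊢
      omega
    · have h1 := ih (b :: c :: st)
      have h2 := ih st
      simp only [List.cons_append, stackCount_cons_cons] at h1 ⊢
      split_ifs <;> omega

lemma stackCount_le_wrap_replicate (v : ℕ) (w : List Bool) :
    stackCount [] w ≤
      stackCount [] (List.replicate v true ++ (w ++ List.replicate v false)) := by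
  induction v with
  | zero => simp
  | succ v ih =>
    refine ih.trans ((stackCount_le_wrap _ []).trans ?_)
    rw [List.replicate_succ, List.replicate_succ', List.cons_append, stackCount_nil_cons]
    simp

/-- Ones minus zeros of a word. -/
def excess (w : List Bool) : ℤ := (w.count true : ℤ) - w.count false

@[simp] lemma excess_append (u w : List Bool) : excess (u ++ w) = excess u + excess w := by
  simp only [excess, List.count_append]
  push_cast
  ring

@[simp] lemma excess_replicate_true (k : ℕ) : excess (List.replicate k true) = k := by
  simp [excess, List.count_replicate]

@[simp] lemma excess_replicate_false (k : ℕ) : excess (List.replicate k false) = -k := by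
  simp [excess, List.count_replicate]

/-- The word with run lengths given by a list of pairs. -/
def pairWord (l : List (ℕ × ℕ)) : List Bool :=
  l.flatMap fun x => List.replicate x.1 true ++ List.replicate x.2 false

lemma stackCount_pairWord_le {h : ℕ} (l : List (ℕ × ℕ)) (hl : l ≠ []) (v v' : ℕ)
    (hv : ∀ u, u <+: pairWord l → 0 ≤ v + excess u ∧ v + excess u ≤ h)
    (hv' : (v' : ℤ) = v + excess (pairWord l)) (st : List Bool) :
    stackCount st (List.replicate v true ++ (pairWord l ++ List.replicate v' false)) ≤
      stackCount st (altRuns h true (2 * l.length)) := by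
  induction l generalizing v st with
  | nil => exact absurd rfl hl
  | cons x l ih =>
    obtain ⟨a, c⟩ := x
    have hw : pairWord ((a, c) :: l) =
        List.replicate a true ++ (List.replicate c false ++ pairWord l) := by
      simp [pairWord]
    have hpeak := hv (List.replicate a true) (by rw [hw]; exact List.prefix_append _ _)
    have hvalley := hv (List.replicate a true ++ List.replicate c false)
      (by rw [hw, ← List.append_assoc]; exact List.prefix_append _ _)
    simp only [excess_append, excess_replicate_true, excess_replicate_false] at hpeak hvalley
    obtain ⟨k, hk⟩ : ∃ k, v + a + k = h := ⟨h - (v + a), by omega⟩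
    obtain ⟨z, hz⟩ : ∃ z, z + c = v + a := ⟨v + a - c, by omega⟩
    have key : ∀ y st, stackCount st (List.replicate v true ++
        (List.replicate a true ++ (List.replicate c false ++ y))) ≤
        stackCount st (List.replicate h true ++
          (List.replicate (k + c) false ++ y)) := by
      intro y st
      have h1 := stackCount_append_mono
        (fun st => stackCount_le_insert true k st (List.replicate c false ++ y))
        (List.replicate (v + a) true) st
      rw [List.replicate_add v a] at h1
      rw [← hk, List.replicate_add (v + a) k, List.replicate_add k c, List.replicate_add v a]
      simpa only [List.append_assoc, Bool.not_true] using h1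
    have hruns : altRuns h true (2 * ((a, c) :: l).length) =
        List.replicate h true ++ (List.replicate (k + c) false ++
          (List.replicate z false ++ altRuns h true (2 * l.length))) := by
      have e : h = k + c + z := by omega
      rw [List.length_cons, Nat.mul_add, altRuns, altRuns]
      nth_rewrite 2 [e]
      rw [List.replicate_add]
      simp only [List.append_assoc, Bool.not_true, Bool.not_false]
    rw [hruns, hw]
    simp only [List.append_assoc]
    refine (key _ st).trans ?_
    rcases eq_or_ne l [] with rfl | hl'
    · have : v' = z := by
        have h0 : excess (pairWord []) = 0 := by simp [pairWord, excess]
        rw [hw, excess_append, excess_append, h0, excess_replicate_true,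
          excess_replicate_false] at hv'
        omega
      subst this
      simp [pairWord, altRuns]
    · refine stackCount_append_mono (fun st => stackCount_append_mono (fun st => ?_) _ st) _ st
      refine (stackCount_le_insert false z st _).trans ?_
      refine stackCount_append_mono (fun st => ih hl' z ?_ ?_ st) _ st
      · intro u hu
        have := hv (List.replicate a true ++ (List.replicate c false ++ u)) (by
          rw [hw]
          exact (List.prefix_append_right_inj _).2 ((List.prefix_append_right_inj _).2 hu))
        simp only [excess_append, excess_replicate_true, excess_replicate_false] at this
        omega
      · rw [hv', hw]
        simp only [excess_append, excess_replicate_true, excess_replicate_false]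
        omega

lemma excess_runsF {r : ℕ} (n m : Fin r → ℕ) :
    excess (runsF n m) = ∑ i, (n i : ℤ) - ∑ i, (m i : ℤ) := by
  rw [Fin.sum_univ_def, Fin.sum_univ_def, runsF]
  induction List.finRange r with
  | nil => simp [excess]
  | cons i l ih =>
    simp only [List.flatMap_cons, excess_append, ih, excess_replicate_true,
      excess_replicate_false, List.map_cons, List.sum_cons]
    ring

lemma phi_runsF_le {r : ℕ} (hr : 1 ≤ r) (n m : Fin r → ℕ) {h : ℕ} (hh : 0 < h) (v : ℕ)
    (hbal : ∑ i, n i = ∑ i, m i)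
    (hv : ∀ u, u <+: runsF n m → 0 ≤ v + excess u ∧ v + excess u ≤ h) :
    phi (runsF n m) ≤ raney h r 1 := by
  have hw : runsF n m = pairWord ((List.finRange r).map fun i => (n i, m i)) := by
    simp [runsF, pairWord, List.flatMap_map]
  have hex : excess (runsF n m) = 0 := by
    rw [excess_runsF, sub_eq_zero]
    exact_mod_cast hbal
  refine (phi_le_stackCount _).trans ((stackCount_le_wrap_replicate v _).trans ?_)
  rw [hw] at hv hex ⊢
  refine (stackCount_pairWord_le _ ?_ v v hv (by rw [hex, add_zero]) []).trans ?_
  · intro h0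
    have := congrArg List.length h0
    simp at this
    omega
  · rw [List.length_map, List.length_finRange]
    exact stackCount_fullRuns_le hh hr

lemma choose_mul_factorial_le (h r : ℕ) (hr : 1 ≤ r) :
    ((h + 1) * r).choose r * r.factorial ≤ (r * (1 + h)) ^ (r - 1) * (h * r + 1) := by
  obtain ⟨s, rfl⟩ : ∃ s, r = s + 1 := ⟨r - 1, by omega⟩
  rw [mul_comm (Nat.choose _ _), ← Nat.descFactorial_eq_factorial_mul_choose,
    Nat.descFactorial_succ, mul_comm]
  have e : (h + 1) * (s + 1) - s = h * (s + 1) + 1 := by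
    have : (h + 1) * (s + 1) = h * (s + 1) + 1 + s := by ring
    omega
  rw [e, Nat.add_sub_cancel]
  refine Nat.mul_le_mul_right _ ((Nat.descFactorial_le_pow _ _).trans (le_of_eq ?_))
  ring

/-- upper bound via height. With `h = h(S)` the lattice-path
height of the balanced word `S = 1^{n₁}0^{m₁}⋯1^{n_r}0^{m_r}`, one has
`φ(S) ≤ C_r^{(h)} = C((h+1)r, r)/(hr+1)` and
`C_r^{(h)} ≤ (r^{r-1}/r!)·(1+h)^{r-1}` over ℝ. -/
theorem stmt8 (r : ℕ) (hr : 1 ≤ r) (n m : Fin r → ℕ)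
    (hn : ∀ i, 1 ≤ n i) (hm : ∀ i, 1 ≤ m i) (hbal : ∑ i, n i = ∑ i, m i)
    (mY : ℤ)
    (hmY : IsLeast {y : ℤ | ∃ i : Fin (runsF n m).length, Yval (runsF n m) (i.val + 1) = y} mY)
    (h : ℕ)
    (hh : IsGreatest {z : ℤ | ∃ i : Fin (runsF n m).length, heightAt (runsF n m) mY i = z} (h : ℤ)) :
    (phi (runsF n m) : ℝ) ≤ (Nat.choose ((h + 1) * r) r : ℝ) / ((h : ℝ) * r + 1) ∧
    (Nat.choose ((h + 1) * r) r : ℝ) / ((h : ℝ) * r + 1) ≤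
      (r : ℝ) ^ (r - 1) / (Nat.factorial r : ℝ) * (1 + (h : ℝ)) ^ (r - 1) := by
  have hpos : (0 : ℝ) < (h : ℝ) * r + 1 := by positivity
  have hYex : ∀ i, Yval (runsF n m) i = excess ((runsF n m).take i) := fun i => rfl
  have hex : excess (runsF n m) = 0 := by
    rw [excess_runsF, sub_eq_zero]
    exact_mod_cast hbal
  obtain ⟨⟨⟨i₀, hi₀⟩, -⟩, hlow⟩ := hmY
  have hmin : mY ≤ 0 := by
    refine hlow ⟨⟨(runsF n m).length - 1, by omega⟩, ?_⟩
    rw [hYex, List.take_of_length_le (by dsimp only; omega), hex]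
  have hbound : ∀ i, i < (runsF n m).length →
      mY ≤ Yval (runsF n m) (i + 1) ∧ Yval (runsF n m) (i + 1) ≤ mY + h := by
    intro i hi
    refine ⟨hlow ⟨⟨i, hi⟩, rfl⟩, ?_⟩
    have := hh.2 ⟨⟨i, hi⟩, rfl⟩
    unfold heightAt at this
    dsimp only at this
    split_ifs at this <;> omega
  have hzero : 0 ≤ mY + h := by
    have := (hbound ((runsF n m).length - 1) (by omega)).2
    rwa [hYex, List.take_of_length_le (by omega), hex] at this
  obtain ⟨v, hv⟩ : ∃ v : ℕ, (v : ℤ) = -mY := ⟨(-mY).toNat, by omega⟩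
  have hpre : ∀ u, u <+: runsF n m → 0 ≤ v + excess u ∧ v + excess u ≤ h := by
    intro u hu
    rw [List.prefix_iff_eq_take.1 hu]
    rcases hk : u.length with _ | k
    · simp [excess]
      omega
    · have := hbound k (by have := hu.length_le; omega)
      rw [hYex] at this
      omega
  have hpos_h : 0 < h := by
    rcases hw : runsF n m with _ | ⟨b, w⟩
    · rw [hw] at hi₀
      simp at hi₀
    · have := hpre [b] (by rw [hw]; simp)
      cases b <;> simp [excess] at this <;> omega
  constructor
  · rw [le_div_iff₀ hpos]
    have h1 := Nat.mul_le_mul_right (h * r + 1) (phi_runsF_le hr n m hpos_h v hbal hpre)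
    rw [raney_one_mul] at h1
    exact_mod_cast h1
  · have h1 := choose_mul_factorial_le h r hr
    have hf : (0 : ℝ) < (r.factorial : ℝ) := by exact_mod_cast r.factorial_pos
    rw [div_mul_eq_mul_div, div_le_div_iff₀ hpos hf, ← mul_pow]
    exact_mod_cast h1
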